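/- For all δ ≥ 0, λ ≥ 1, c ≥ 0 and all functions R, N : [0,∞) → [0,∞), there exists θ > 0 such that the following holds. Let Y be a geodesic δ-hyperbolic metric space and G a group acting on Y by isometries with kernel K = {g ∈ G : g·y = y for all y ∈ Y}, such that for every r ≥ 0 and all a, b ∈ Y with d(a,b) ≥ R(r), the set of cosets {gK : d(g·a,a) ≤ r and d(g·b,b) ≤ r} has at most N(r) elements. Let g ∈ G be a loxodromic element with a (λ,c)-quasi-axis A ⊆ Y, and suppose that the subgroup EC(g) = {h ∈ G : the Hausdorff distance between h·A and A is finite} is separable in G. Then there exists a finite-index subgroup G' of G such that for every h ∈ G', either the Hausdorff distance between h·A and A is finite, or diam π_A(h·A) < θ, where π_A(S) denotes the set of all 1-approximate nearest points on A of points of S. -/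

import Mathlib

open Pointwise

/-- `γ` is a geodesic from `x` to `y`. -/
def IsGeodesicFrom {X : Type*} [MetricSpace X] (γ : ℝ → X) (x y : X) : Prop :=
  γ 0 = x ∧ γ (dist x y) = y ∧
    ∀ s ∈ Set.Icc (0 : ℝ) (dist x y), ∀ t ∈ Set.Icc (0 : ℝ) (dist x y),
      dist (γ s) (γ t) = |s - t|

/-- A metric space is geodesic if any two points are joined by a geodesic. -/
def IsGeodesicSpace (X : Type*) [MetricSpace X] : Prop :=
  ∀ x y : X, ∃ γ : ℝ → X, IsGeodesicFrom γ x y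

/-- A geodesic space is `δ`-hyperbolic if each side of any geodesic triangle is
contained in the closed `δ`-neighborhood of the union of the other two sides. -/
def IsDeltaHyperbolic (X : Type*) [MetricSpace X] (δ : ℝ) : Prop :=
  ∀ x y z : X, ∀ g₁ g₂ g₃ : ℝ → X,
    IsGeodesicFrom g₁ x y → IsGeodesicFrom g₂ y z → IsGeodesicFrom g₃ x z →
    ∀ p ∈ g₁ '' Set.Icc (0 : ℝ) (dist x y),
      ∃ q ∈ (g₂ '' Set.Icc (0 : ℝ) (dist y z)) ∪ (g₃ '' Set.Icc (0 : ℝ) (dist x z)),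
        dist p q ≤ δ

/-- `γ` is a `(lam, c)`-quasi-geodesic on the interval `I ⊆ ℝ`. -/
def IsQuasiGeodesicOn {X : Type*} [MetricSpace X] (lam c : ℝ) (γ : ℝ → X)
    (I : Set ℝ) : Prop :=
  ∀ s ∈ I, ∀ t ∈ I,
    (1 / lam) * |s - t| - c ≤ dist (γ s) (γ t) ∧ dist (γ s) (γ t) ≤ lam * |s - t| + c

/-- The set of all 1-approximate nearest points on `A` of points of `S`. -/
def approxProj {X : Type*} [MetricSpace X] (A S : Set X) : Set X :=
  {p : X | p ∈ A ∧ ∃ s ∈ S, dist s p ≤ Metric.infDist s A + 1}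

/-- A subset `S` of a group `G` is separable if it equals the intersection of
all finite-index subgroups of `G` containing it. -/
def IsSeparableSet {G : Type*} [Group G] (S : Set G) : Prop :=
  S = ⋂ K ∈ {K : Subgroup G | S ⊆ K ∧ K.FiniteIndex}, (K : Set G)

/-- `p` lies on a geodesic segment from `x` to `y`, expressed metrically. -/
def MetricBetween {X : Type*} [MetricSpace X] (x p y : X) : Prop :=
  dist x p + dist p y = dist x y

/-- Thin triangles, expressed through metric betweenness. -/
def HasThinTriangles (X : Type*) [MetricSpace X] (δ : ℝ) : Prop :=
  ∀ x y z p : X, MetricBetween x p y →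
    ∃ q, dist p q ≤ δ ∧ (MetricBetween y q z ∨ MetricBetween x q z)

section Hyperbolic

variable {X : Type*} [MetricSpace X]

theorem MetricBetween.symm {x p y : X} (h : MetricBetween x p y) : MetricBetween y p x := by
  unfold MetricBetween at *
  rw [dist_comm y p, dist_comm p x, dist_comm y x]
  linarith

theorem MetricBetween.trans_left {x q p y : X} (h : MetricBetween x p y)
    (hq : MetricBetween x q p) : MetricBetween x q y ∧ MetricBetween q p y := by
  unfold MetricBetween at *
  have h₁ := dist_triangle q p y
  have h₂ := dist_triangle x q y
  constructor <;> linarith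

theorem metricBetween_left (x y : X) : MetricBetween x x y := by
  simp [MetricBetween]

theorem IsGeodesicFrom.metricBetween {γ : ℝ → X} {x y : X} (h : IsGeodesicFrom γ x y)
    {t : ℝ} (ht : t ∈ Set.Icc 0 (dist x y)) :
    MetricBetween x (γ t) y ∧ dist x (γ t) = t := by
  obtain ⟨h0, h1, h2⟩ := h
  have a := h2 0 ⟨le_rfl, dist_nonneg⟩ t ht
  have b := h2 t ht (dist x y) ⟨dist_nonneg, le_rfl⟩
  rw [h0, zero_sub, abs_neg, abs_of_nonneg ht.1] at a
  rw [h1, abs_of_nonpos (by linarith [ht.2])] at b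
  refine ⟨?_, a⟩
  unfold MetricBetween
  linarith

theorem IsGeodesicSpace.exists_metricBetween (h : IsGeodesicSpace X) (x y : X) {r : ℝ}
    (hr : 0 ≤ r) (hr' : r ≤ dist x y) : ∃ p, MetricBetween x p y ∧ dist x p = r := by
  obtain ⟨γ, hγ⟩ := h x y
  exact ⟨γ r, hγ.metricBetween ⟨hr, hr'⟩⟩

theorem IsGeodesicSpace.exists_geodesic_through (h : IsGeodesicSpace X) {x p y : X}
    (hp : MetricBetween x p y) :
    ∃ γ : ℝ → X, IsGeodesicFrom γ x y ∧ p ∈ γ '' Set.Icc 0 (dist x y) := by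
  obtain ⟨γ₁, h₁⟩ := h x p
  obtain ⟨γ₂, h₂⟩ := h p y
  unfold MetricBetween at hp
  have hxp : 0 ≤ dist x p := dist_nonneg
  have hpy : 0 ≤ dist p y := dist_nonneg
  set γ : ℝ → X := fun s => if s ≤ dist x p then γ₁ s else γ₂ (s - dist x p) with hγ
  have first : ∀ s, s ≤ dist x p → γ s = γ₁ s := fun s hs => by simp [hγ, hs]
  have second : ∀ s, dist x p < s → γ s = γ₂ (s - dist x p) := fun s hs => by
    simp [hγ, not_le.2 hs]
  have key : ∀ s t, 0 ≤ s → s ≤ t → t ≤ dist x y → dist (γ s) (γ t) = t - s := by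
    intro s t hs hst ht
    rcases le_or_gt t (dist x p) with htp | htp
    · rw [first s (hst.trans htp), first t htp,
        h₁.2.2 s ⟨hs, hst.trans htp⟩ t ⟨hs.trans hst, htp⟩, abs_of_nonpos (by linarith)]
      ring
    rcases le_or_gt s (dist x p) with hsp | hsp
    · rw [first s hsp, second t htp]
      have a := h₁.metricBetween ⟨hs, hsp⟩
      have b := h₂.metricBetween (t := t - dist x p) ⟨by linarith, by linarith⟩
      unfold MetricBetween at a b
      have c₁ := dist_triangle (γ₁ s) p (γ₂ (t - dist x p))
      have c₂ := dist_triangle4 x (γ₁ s) (γ₂ (t - dist x p)) y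
      linarith
    · rw [second s hsp, second t htp, h₂.2.2 _ ⟨by linarith, by linarith⟩ _
        ⟨by linarith, by linarith⟩, abs_of_nonpos (by linarith)]
      ring
  have mid : γ (dist x p) = p := by rw [first _ le_rfl, h₁.2.1]
  refine ⟨γ, ⟨?_, ?_, ?_⟩, dist x p, ⟨hxp, by linarith⟩, mid⟩
  · rw [first 0 hxp, h₁.1]
  · rcases hpy.eq_or_lt with h0 | h0
    · rw [← hp, ← h0, add_zero, mid]
      exact dist_eq_zero.1 h0.symm
    · rw [second _ (by linarith), ← hp, add_sub_cancel_left, h₂.2.1]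
  · intro s hs t ht
    rcases le_total s t with hst | hst
    · rw [key s t hs.1 hst ht.2, abs_of_nonpos (by linarith)]
      ring
    · rw [dist_comm, key t s ht.1 hst hs.2, abs_of_nonneg (by linarith)]

theorem IsDeltaHyperbolic.hasThinTriangles {δ : ℝ} (hg : IsGeodesicSpace X)
    (h : IsDeltaHyperbolic X δ) : HasThinTriangles X δ := by
  intro x y z p hp
  obtain ⟨γ₁, h₁, hpm⟩ := hg.exists_geodesic_through hp
  obtain ⟨γ₂, h₂⟩ := hg y z
  obtain ⟨γ₃, h₃⟩ := hg x z
  obtain ⟨q, hq, hpq⟩ := h x y z γ₁ γ₂ γ₃ h₁ h₂ h₃ p hpm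
  refine ⟨q, hpq, ?_⟩
  rcases hq with ⟨t, ht, rfl⟩ | ⟨t, ht, rfl⟩
  · exact Or.inl (h₂.metricBetween ht).1
  · exact Or.inr (h₃.metricBetween ht).1

theorem HasThinTriangles.quadrilateral {δ : ℝ} (hδ : 0 ≤ δ) (h : HasThinTriangles X δ)
    (x y z w : X) {p : X} (hp : MetricBetween x p w) :
    ∃ q, dist p q ≤ 2 * δ ∧
      (MetricBetween x q y ∨ MetricBetween y q z ∨ MetricBetween z q w) := by
  obtain ⟨q, hpq, hq | hq⟩ := h x w y p hp
  · obtain ⟨q', hqq', hq'⟩ := h w y z q hq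
    refine ⟨q', by linarith [dist_triangle p q q'], ?_⟩
    rcases hq' with hq' | hq'
    · exact Or.inr (Or.inl hq')
    · exact Or.inr (Or.inr hq'.symm)
  · exact ⟨q, by linarith, Or.inl hq⟩

/-- A geodesic between two points of a quasi-geodesic is logarithmically close to it. -/
theorem HasThinTriangles.exists_dist_le_log {δ lam c : ℝ} (h : HasThinTriangles X δ)
    (hlam : 1 ≤ lam) {γ : ℝ → X} (hγ : IsQuasiGeodesicOn lam c γ Set.univ) (k : ℕ) :
    ∀ (s t : ℝ) (p : X), |s - t| ≤ 2 ^ k → MetricBetween (γ s) p (γ t) →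
      ∃ u, dist p (γ u) ≤ k * δ + (lam + c) := by
  induction k with
  | zero =>
    intro s t p hst hp
    refine ⟨s, ?_⟩
    have h₁ := (hγ s trivial t trivial).2
    have h₂ : dist p (γ t) ≥ 0 := dist_nonneg
    unfold MetricBetween at hp
    rw [dist_comm p]
    rw [pow_zero] at hst
    push_cast
    nlinarith
  | succ k ih =>
    intro s t p hst hp
    have hhalf : |s - t| / 2 ≤ 2 ^ k := by
      rw [pow_succ] at hst
      linarith
    obtain ⟨q, hpq, hq | hq⟩ := h _ _ (γ ((s + t) / 2)) p hp
    · obtain ⟨u, hu⟩ := ih t ((s + t) / 2) q (by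
        rwa [show t - (s + t) / 2 = -((s - t) / 2) by ring, abs_neg, abs_div, abs_two]) hq
      refine ⟨u, ?_⟩
      push_cast
      linarith [dist_triangle p q (γ u)]
    · obtain ⟨u, hu⟩ := ih s ((s + t) / 2) q (by
        rwa [show s - (s + t) / 2 = (s - t) / 2 by ring, abs_div, abs_two]) hq
      refine ⟨u, ?_⟩
      push_cast
      linarith [dist_triangle p q (γ u)]

end Hyperbolic

theorem exists_forall_linear_le_two_pow (a b : ℝ) :
    ∃ k₀ : ℕ, ∀ k : ℕ, k₀ ≤ k → a * k + b ≤ 2 ^ k := by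
  have h₁ := (tendsto_pow_const_div_const_pow_of_one_lt 1 (one_lt_two (α := ℝ))).const_mul a
  have h₂ := (tendsto_pow_const_div_const_pow_of_one_lt 0 (one_lt_two (α := ℝ))).const_mul b
  have h₃ := h₁.add h₂
  have h₄ := h₃.eventually (gt_mem_nhds (show a * 0 + b * 0 < (1 : ℝ) by norm_num))
  obtain ⟨k₀, hk₀⟩ := Filter.eventually_atTop.1 h₄
  refine ⟨k₀, fun k hk => ?_⟩
  have := hk₀ k hk
  have hpos : (0 : ℝ) < 2 ^ k := by positivity
  rw [← mul_div_assoc, ← mul_div_assoc, ← add_div, div_lt_one hpos] at this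
  simpa using this.le

theorem exists_bound_of_logarithmic_bound {δ a : ℝ} (b e : ℝ) (hδ : 0 ≤ δ) (ha : 0 ≤ a) :
    ∃ B : ℝ, ∀ D : ℝ, (∀ k : ℕ, a * D + b ≤ 2 ^ k → D ≤ e + k * δ) → D ≤ B := by
  obtain ⟨k₀, hk₀⟩ := exists_forall_linear_le_two_pow (a * δ) (a * (e + δ) + b)
  refine ⟨e + (k₀ + 1) * δ, fun D hD => ?_⟩
  have hex : ∃ k : ℕ, a * D + b ≤ 2 ^ k :=
    (pow_unbounded_of_one_lt _ one_lt_two).imp fun _ => le_of_lt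
  classical
  have hspec := hD _ (Nat.find_spec hex)
  have hle : Nat.find hex ≤ k₀ + 1 := by
    by_contra! hlt
    obtain ⟨m, hm⟩ : ∃ m, Nat.find hex = m + 1 := ⟨Nat.find hex - 1, by omega⟩
    rw [hm] at hspec hlt
    refine Nat.find_min hex (m := m) (by omega) (le_trans ?_ (hk₀ m (by omega)))
    push_cast at hspec
    nlinarith
  have : (Nat.find hex : ℝ) ≤ k₀ + 1 := by exact_mod_cast hle
  nlinarith

/-- Geodesics joining points of a quasi-geodesic line stay uniformly close to it. -/
theorem exists_quasiconvexity_constant {δ lam : ℝ} (c : ℝ) (hδ : 0 ≤ δ) (hlam : 1 ≤ lam) :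
    ∃ B : ℝ, 0 ≤ B ∧ ∀ (X : Type*) [MetricSpace X], IsGeodesicSpace X → HasThinTriangles X δ →
      ∀ γ : ℝ → X, IsQuasiGeodesicOn lam c γ Set.univ →
      ∀ x ∈ Set.range γ, ∀ y ∈ Set.range γ, ∀ p, MetricBetween x p y →
        Metric.infDist p (Set.range γ) ≤ B := by
  obtain ⟨B, hB⟩ := exists_bound_of_logarithmic_bound (δ := δ) (a := 6 * lam)
    (lam * (4 * δ + 8 + c)) (2 * δ + (lam + c) + 1) hδ (by linarith)
  refine ⟨max B (2 * δ + 1), le_max_of_le_right (by linarith), ?_⟩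
  intro X _ hgeo hthin γ hγ x hx y hy p₀ hp₀
  set A := Set.range γ
  have hA : A.Nonempty := ⟨x, hx⟩
  set S : Set ℝ := (fun p => Metric.infDist p A) '' {p | MetricBetween x p y}
  have hS : BddAbove S := by
    refine ⟨dist x y, ?_⟩
    rintro _ ⟨p, hp, rfl⟩
    have h₁ : Metric.infDist p A ≤ dist p x := Metric.infDist_le_dist_of_mem hx
    have h₂ : 0 ≤ dist p y := dist_nonneg
    have h₃ : dist x p + dist p y = dist x y := hp
    rw [dist_comm] at h₁
    show Metric.infDist p A ≤ _
    linarith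
  have hmem : Metric.infDist p₀ A ∈ S := ⟨p₀, hp₀, rfl⟩
  set D := sSup S
  have hle : ∀ p, MetricBetween x p y → Metric.infDist p A ≤ D := fun p hp =>
    le_csSup hS ⟨p, hp, rfl⟩
  have hD0 : 0 ≤ D := Metric.infDist_nonneg.trans (hle p₀ hp₀)
  obtain ⟨_, ⟨p, hp, rfl⟩, hpD⟩ := exists_lt_of_lt_csSup ⟨_, hmem⟩ (show D - 1 < D by linarith)
  replace hpD : D - 1 < Metric.infDist p A := hpD
  refine (hle p₀ hp₀).trans ?_
  by_contra! hDB
  have hDδ : 2 * δ + 1 < D := (le_max_right _ _).trans_lt hDB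
  refine absurd (hB D ?_) (not_le.2 ((le_max_left _ _).trans_lt hDB))
  intro k hk
  have side : ∀ x y : X, x ∈ A → MetricBetween x p y →
      (∀ q, MetricBetween x q y → Metric.infDist q A ≤ D) →
      ∃ q, MetricBetween x q p ∧ ∃ a ∈ A, dist p a ≤ 3 * D + 2 * δ + 3 ∧
        ∀ u, MetricBetween q u a → 2 * δ < dist p u := by
    intro x y hx hp hle
    rcases le_or_gt (dist x p) (2 * D + 2 * δ + 2) with hsmall | hbig
    · refine ⟨x, metricBetween_left x p, x, hx, by rw [dist_comm]; linarith, ?_⟩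
      intro u hu
      unfold MetricBetween at hu
      rw [dist_self] at hu
      have h₁ : 0 ≤ dist x u := dist_nonneg
      have h₂ : 0 ≤ dist u x := dist_nonneg
      obtain rfl : x = u := dist_eq_zero.1 (by linarith)
      have := Metric.infDist_le_dist_of_mem (x := p) hx
      linarith
    · obtain ⟨q, hq, hxq⟩ := hgeo.exists_metricBetween x p
        (r := dist x p - (2 * D + 2 * δ + 2)) (by linarith) (by linarith)
      have hqA : Metric.infDist q A < D + 1 := by
        linarith [hle q (hp.trans_left hq).1]
      obtain ⟨a, ha, hqa⟩ := (Metric.infDist_lt_iff hA).1 hqA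
      have hqp : dist q p = 2 * D + 2 * δ + 2 := by
        unfold MetricBetween at hq
        linarith
      refine ⟨q, hq, a, ha, ?_, ?_⟩
      · have := dist_triangle p q a
        rw [dist_comm p q] at this
        linarith
      · intro u hu
        unfold MetricBetween at hu
        have h₁ := dist_triangle q u p
        have h₂ : 0 ≤ dist u a := dist_nonneg
        rw [dist_comm u p] at h₁
        linarith
  obtain ⟨q, hq, _, ⟨s, rfl⟩, hps, hqs⟩ := side x y hx hp hle
  obtain ⟨r, hr, _, ⟨t, rfl⟩, hpt, hrt⟩ := side y x hy hp.symm fun q hq => hle q hq.symm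
  have hqpr : MetricBetween q p r :=
    ((hp.symm.trans_left hr).2.symm.trans_left hq).2
  obtain ⟨u, hpu, hu | hu | hu⟩ := hthin.quadrilateral hδ q (γ s) (γ t) r hqpr
  · linarith [hqs u hu]
  · have hst : |s - t| ≤ 2 ^ k := by
      refine le_trans ?_ hk
      have h₁ := (hγ s trivial t trivial).1
      have h₂ := dist_triangle (γ s) p (γ t)
      rw [dist_comm (γ s) p] at h₂
      have h₃ : 1 / lam * |s - t| ≤ 6 * D + 4 * δ + 8 + c := by linarith
      have hpos : 0 < lam := by linarith
      rw [one_div, inv_mul_le_iff₀ hpos] at h₃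
      linarith
    obtain ⟨v, hv⟩ := hthin.exists_dist_le_log hlam hγ k s t u hst hu
    have h₁ : Metric.infDist p A ≤ dist p (γ v) := Metric.infDist_le_dist_of_mem ⟨v, rfl⟩
    linarith [dist_triangle p u (γ v)]
  · linarith [hrt u hu.symm]

/-- If two points have far apart approximate projections to a quasiconvex set, a geodesic joining
the projections is, away from its endpoints, close to a geodesic joining the two points. -/
theorem HasThinTriangles.exists_near_of_approxProj {X : Type*} [MetricSpace X] {δ B : ℝ}
    (hδ : 0 ≤ δ) (hthin : HasThinTriangles X δ) {A : Set X}
    {x y p q m : X} (hp : p ∈ A) (hq : q ∈ A)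
    (hxp : dist x p ≤ Metric.infDist x A + 1) (hyq : dist y q ≤ Metric.infDist y A + 1)
    (hm : MetricBetween p m q) (hmA : Metric.infDist m A ≤ B)
    (hpm : 4 * δ + B + 1 < dist p m) (hqm : 4 * δ + B + 1 < dist q m) :
    ∃ u, dist m u ≤ 2 * δ ∧ MetricBetween x u y := by
  have side : ∀ x p u : X, p ∈ A → dist x p ≤ Metric.infDist x A + 1 → MetricBetween p u x →
      dist m u ≤ 2 * δ → dist p m ≤ 4 * δ + B + 1 := by
    intro x p u hp hxp hu hmu
    have h₁ : Metric.infDist x A ≤ Metric.infDist u A + dist x u :=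
      Metric.infDist_le_infDist_add_dist
    have h₂ : Metric.infDist u A ≤ Metric.infDist m A + dist u m :=
      Metric.infDist_le_infDist_add_dist
    have h₃ := dist_triangle p u m
    unfold MetricBetween at hu
    rw [dist_comm u m] at h₂ h₃
    rw [dist_comm x u] at h₁
    rw [dist_comm x p] at hxp
    linarith
  obtain ⟨u, hmu, hu | hu | hu⟩ := hthin.quadrilateral hδ p x y q hm
  · linarith [side x p u hp hxp hu hmu]
  · exact ⟨u, hmu, hu⟩
  · linarith [side y q u hq hyq hu.symm hmu]

theorem exists_near_of_coarse_int_line_of_pos {t : ℤ → ℝ} {C : ℝ} {M : ℤ} (hM : 0 < M)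
    (hC : 1 ≤ C) (hstep : ∀ n, |t (n + 1) - t n| ≤ C)
    (hfar : ∀ n, 2 * C < |t (n + M) - t n|) (hpos : 0 < t M - t 0) :
    ∃ T, ∀ s, ∃ n, |t n - s| ≤ T := by
  have hv : ∀ n, 0 < t (n + M) - t n := by
    intro n
    induction n using Int.induction_on with
    | zero => simpa using hpos
    | succ n ih =>
      by_contra! hneg
      have h₁ := hfar (n + 1)
      rw [abs_of_nonpos hneg] at h₁
      have h₂ := abs_le.1 (hstep n)
      have h₃ := abs_le.1 (hstep (n + M))
      rw [show (n : ℤ) + M + 1 = n + 1 + M by ring] at h₃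
      linarith
    | pred n ih =>
      by_contra! hneg
      have h₁ := hfar (-n - 1)
      rw [abs_of_nonpos hneg] at h₁
      have h₂ := abs_le.1 (hstep (-n - 1))
      have h₃ := abs_le.1 (hstep (-n - 1 + M))
      rw [show (-n : ℤ) - 1 + M + 1 = -n + M by ring] at h₃
      rw [show (-n : ℤ) - 1 + 1 = -n by ring] at h₂
      linarith
  have hgap : ∀ n, 2 ≤ t (n + M) - t n := fun n => by
    have := hfar n
    rw [abs_of_pos (hv n)] at this
    linarith
  have hup : ∀ (k : ℕ) (n : ℤ), |t (n + k) - t n| ≤ k * C := by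
    intro k
    induction k with
    | zero => simp
    | succ k ih =>
      intro n
      have h₁ := hstep (n + k)
      have h₂ := abs_add_le (t (n + k + 1) - t (n + k)) (t (n + k) - t n)
      rw [sub_add_sub_cancel] at h₂
      push_cast
      rw [← add_assoc]
      linarith [ih n]
  have hmono : Monotone fun n : ℤ => t (M * n) - n := by
    refine monotone_int_of_le_succ fun n => ?_
    have := hgap (M * n)
    rw [show M * n + M = M * (n + 1) by ring] at this
    push_cast
    linarith
  refine ⟨M.toNat * C, fun s => ?_⟩
  obtain ⟨n, hn, hmax⟩ : ∃ n : ℤ, t (M * n) ≤ s ∧ ∀ m : ℤ, t (M * m) ≤ s → m ≤ n := by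
    refine Int.exists_greatest_of_bdd ⟨max 0 ⌈s - t 0⌉, fun m hm => ?_⟩
      ⟨min 0 ⌊s - t 0⌋, ?_⟩
    · rcases le_total m 0 with h | h
      · exact h.trans (le_max_left _ _)
      · refine le_max_of_le_right ?_
        have := hmono h
        simp only [mul_zero, Int.cast_zero, sub_zero] at this
        have h₁ := Int.le_ceil (s - t 0)
        have : (m : ℝ) ≤ (⌈s - t 0⌉ : ℤ) := by linarith
        exact_mod_cast this
    · have := hmono (min_le_left 0 ⌊s - t 0⌋)
      simp only [mul_zero, Int.cast_zero, sub_zero] at this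
      have h₁ : ((min 0 ⌊s - t 0⌋ : ℤ) : ℝ) ≤ (⌊s - t 0⌋ : ℤ) := by
        exact_mod_cast min_le_right _ _
      have h₂ := Int.floor_le (s - t 0)
      linarith
  refine ⟨M * n, ?_⟩
  have h₁ : s < t (M * (n + 1)) := by
    by_contra! h
    linarith [hmax _ h]
  have h₂ := le_trans (le_abs_self _) (hup M.toNat (M * n))
  rw [Int.toNat_of_nonneg hM.le, show M * n + M = M * (n + 1) by ring] at h₂
  rw [abs_of_nonpos (by linarith)]
  linarith

/-- A quasi-isometric embedding of the integers into the reals is coarsely surjective. -/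
theorem exists_near_of_coarse_int_line {t : ℤ → ℝ} {C ε : ℝ} (hε : 0 < ε)
    (hstep : ∀ n, |t (n + 1) - t n| ≤ C)
    (hlow : ∀ n m : ℤ, ε * |(n : ℝ) - m| - C ≤ |t n - t m|) :
    ∃ T, ∀ s, ∃ n, |t n - s| ≤ T := by
  obtain ⟨M, hM⟩ := exists_nat_gt (max 1 ((2 * max C 1 + C) / ε))
  have hM0 : (1 : ℝ) < M := (le_max_left _ _).trans_lt hM
  have hM1 : 2 * max C 1 + C < M * ε := by
    rw [← div_lt_iff₀ hε]
    exact (le_max_right _ _).trans_lt hM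
  have hMpos : (0 : ℤ) < M := by
    have : (0 : ℝ) < M := by linarith
    exact_mod_cast this
  have hstep' : ∀ n, |t (n + 1) - t n| ≤ max C 1 := fun n => (hstep n).trans (le_max_left _ _)
  have hfar : ∀ n, 2 * max C 1 < |t (n + M) - t n| := by
    intro n
    have := hlow (n + M) n
    push_cast at this
    rw [add_sub_cancel_left, abs_of_pos (by linarith)] at this
    linarith
  have h0 := hfar 0
  rw [zero_add] at h0
  rcases lt_or_ge 0 (t M - t 0) with h | h
  · exact exists_near_of_coarse_int_line_of_pos hMpos (le_max_right _ _) hstep' hfar h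
  · have hneg : 0 < -t M - -t 0 := by
      rw [abs_of_nonpos h] at h0
      have : 1 ≤ max C 1 := le_max_right _ _
      linarith
    obtain ⟨T, hT⟩ := exists_near_of_coarse_int_line_of_pos (t := fun n => -t n) hMpos
      (le_max_right C 1)
      (fun n => by rw [neg_sub_neg, abs_sub_comm]; exact hstep' n)
      (fun n => by rw [neg_sub_neg, abs_sub_comm]; exact hfar n) hneg
    refine ⟨T, fun s => ?_⟩
    obtain ⟨n, hn⟩ := hT (-s)
    refine ⟨n, ?_⟩
    rwa [neg_sub_neg, abs_sub_comm] at hn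

theorem IsQuasiGeodesicOn.abs_sub_le {X : Type*} [MetricSpace X] {lam c : ℝ} {γ : ℝ → X}
    (hγ : IsQuasiGeodesicOn lam c γ Set.univ) (hlam : 1 ≤ lam) (s t : ℝ) :
    |s - t| ≤ lam * (dist (γ s) (γ t) + c) := by
  have h₁ := (hγ s trivial t trivial).1
  have hpos : 0 < lam := by linarith
  rw [← inv_mul_le_iff₀ hpos, ← one_div]
  linarith

/-- Bounded parts of a quasi-geodesic line are coarsely finite. -/
theorem IsQuasiGeodesicOn.exists_finite_net {X : Type*} [MetricSpace X] {lam c : ℝ} {γ : ℝ → X}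
    (hγ : IsQuasiGeodesicOn lam c γ Set.univ) (hlam : 1 ≤ lam) (T : ℝ) :
    ∃ F : Set X, F.Finite ∧ ∀ x ∈ Set.range γ, dist x (γ 0) ≤ T →
      ∃ f ∈ F, dist x f ≤ lam + c := by
  refine ⟨(fun n : ℤ => γ n) '' Set.Icc ⌊-(lam * (T + c))⌋ ⌊lam * (T + c)⌋,
    (Set.finite_Icc _ _).image _, ?_⟩
  rintro _ ⟨s, rfl⟩ hs
  have h₁ := hγ.abs_sub_le hlam s 0
  rw [sub_zero] at h₁
  have h₂ : |s| ≤ lam * (T + c) := h₁.trans (by gcongr)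
  refine ⟨γ ⌊s⌋, ⟨⌊s⌋, ⟨Int.floor_mono (abs_le.1 h₂).1, Int.floor_mono (abs_le.1 h₂).2⟩, rfl⟩, ?_⟩
  have h₃ := (hγ s trivial ⌊s⌋ trivial).2
  have h₄ : |s - ⌊s⌋| ≤ 1 := by
    rw [abs_of_nonneg (by linarith [Int.floor_le s])]
    linarith [Int.lt_floor_add_one s]
  nlinarith

theorem zpow_smul_mem {Y G : Type*} [Group G] [MulAction G Y] {g : G} {A : Set Y} (hgA : g • A = A)
    (n : ℤ) {a : Y} (ha : a ∈ A) : g ^ n • a ∈ A := by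
  have h : g ^ n ∈ MulAction.stabilizer G A := Subgroup.zpow_mem _ hgA n
  have h' : g ^ n • A = A := h
  rw [← h']
  exact Set.smul_mem_smul_set ha

section Action

variable {Y : Type*} [MetricSpace Y] {G : Type*} [Group G] [MulAction G Y]

theorem dist_smul_of_isometry (hiso : ∀ g : G, Isometry (fun y : Y => g • y)) (g : G) (x y : Y) :
    dist (g • x) (g • y) = dist x y :=
  (hiso g).dist_eq x y

/-- A loxodromic isometry acts coboundedly on each of its quasi-axes. -/
theorem exists_cobounded_on_quasiAxis (hiso : ∀ g : G, Isometry (fun y : Y => g • y)) {g : G}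
    (hlox : ∃ x : Y, ∃ lam' c' : ℝ, 1 ≤ lam' ∧ 0 ≤ c' ∧ ∀ m n : ℤ,
      (1 / lam') * |(m : ℝ) - n| - c' ≤ dist ((g ^ m) • x) ((g ^ n) • x) ∧
      dist ((g ^ m) • x) ((g ^ n) • x) ≤ lam' * |(m : ℝ) - n| + c')
    {lam c : ℝ} (hlam : 1 ≤ lam) {γ : ℝ → Y}
    (hγ : IsQuasiGeodesicOn lam c γ Set.univ) (hg : g • Set.range γ = Set.range γ) :
    ∃ T : ℝ, ∀ a ∈ Set.range γ, ∃ n : ℤ, dist (g ^ n • a) (γ 0) ≤ T := by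
  obtain ⟨x, l, c', hl, hc', hx⟩ := hlox
  have hlpos : 0 < l := by linarith
  have hlampos : 0 < lam := by linarith
  have hmem : ∀ n : ℤ, ∃ t : ℝ, γ t = g ^ n • γ 0 := fun n => zpow_smul_mem hg n ⟨0, rfl⟩
  choose t ht using hmem
  set d := dist x (γ 0)
  have hd : 0 ≤ d := dist_nonneg
  have hlow : ∀ n m : ℤ, 1 / l * |(n : ℝ) - m| - c' - 2 * d ≤ dist (γ (t n)) (γ (t m)) := by
    intro n m
    have h₁ := (hx n m).1
    have h₂ := dist_triangle4 (g ^ n • x) (g ^ n • γ 0) (g ^ m • γ 0) (g ^ m • x)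
    rw [dist_smul_of_isometry hiso, dist_smul_of_isometry hiso (g ^ m), dist_comm (γ 0) x] at h₂
    rw [ht, ht]
    linarith
  have hstep : ∀ n : ℤ, dist (γ (t (n + 1))) (γ (t n)) = dist (g • γ 0) (γ 0) := by
    intro n
    rw [ht, ht, zpow_add, mul_smul, dist_smul_of_isometry hiso, zpow_one]
  set C := max (lam * (dist (g • γ 0) (γ 0) + c)) ((c' + 2 * d + c) / lam)
  obtain ⟨T, hT⟩ := exists_near_of_coarse_int_line (t := t) (C := C) (ε := 1 / l / lam)
    (by positivity)
    (fun n => by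
      have := hγ.abs_sub_le hlam (t (n + 1)) (t n)
      rw [hstep] at this
      exact this.trans (le_max_left _ _))
    (fun n m => by
      have h₁ := hlow n m
      have h₂ := (hγ (t n) trivial (t m) trivial).2
      have h₃ : (1 / l * |(n : ℝ) - m| - (c' + 2 * d + c)) / lam ≤ |t n - t m| := by
        rw [div_le_iff₀ hlampos]
        linarith
      have h₄ : (c' + 2 * d + c) / lam ≤ C := le_max_right _ _
      rw [sub_div, mul_div_right_comm] at h₃
      linarith)
  refine ⟨lam * T + c, ?_⟩
  rintro _ ⟨s, rfl⟩
  obtain ⟨n, hn⟩ := hT s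
  refine ⟨-n, ?_⟩
  have h₁ := (hγ (t n) trivial s trivial).2
  rw [ht, ← dist_smul_of_isometry hiso (g ^ (-n)), smul_smul, ← zpow_add, neg_add_cancel,
    zpow_zero, one_smul, dist_comm] at h₁
  refine h₁.trans ?_
  gcongr

/-- Acylindricity: up to the kernel of the action, finitely many elements coarsely send a given
pair of distant points to a given pair of points. -/
theorem exists_finite_coset_representatives (hiso : ∀ g : G, Isometry (fun y : Y => g • y))
    {r : ℝ} {a b a' b' : Y}
    (hfin : {S : Set G | ∃ g : G, dist (g • a) a ≤ 2 * r ∧ dist (g • b) b ≤ 2 * r ∧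
      S = (fun x => g * x) '' {k : G | ∀ y : Y, k • y = y}}.Finite) :
    ∃ P : Set G, P.Finite ∧ ∀ k : G, dist (k • a) a' ≤ r → dist (k • b) b' ≤ r →
      ∃ p ∈ P, ∀ y : Y, (k⁻¹ * p) • y = y := by
  by_cases hex : ∃ k₀ : G, dist (k₀ • a) a' ≤ r ∧ dist (k₀ • b) b' ≤ r
  · obtain ⟨k₀, hk₀a, hk₀b⟩ := hex
    have hrep : ∀ S : Set G, ∃ s, S.Nonempty → s ∈ S := fun S => by
      by_cases hS : S.Nonempty
      · exact hS.imp fun _ hs _ => hs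
      · exact ⟨1, fun h => absurd h hS⟩
    choose rep hrep using hrep
    refine ⟨_, hfin.image fun S => k₀ * rep S, ?_⟩
    intro k hka hkb
    have move : ∀ x x' : Y, dist (k₀ • x) x' ≤ r → dist (k • x) x' ≤ r →
        dist ((k₀⁻¹ * k) • x) x ≤ 2 * r := by
      intro x x' h₁ h₂
      rw [← dist_smul_of_isometry hiso k₀, smul_smul, mul_inv_cancel_left]
      linarith [dist_triangle_right (k • x) (k₀ • x) x']
    refine ⟨_, ⟨_, ⟨k₀⁻¹ * k, move a a' hk₀a hka, move b b' hk₀b hkb, rfl⟩, rfl⟩, ?_⟩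
    obtain ⟨κ, hκ, hκ'⟩ := hrep ((fun x => k₀⁻¹ * k * x) '' {k : G | ∀ y : Y, k • y = y})
      ⟨_, 1, fun y => one_smul _ y, rfl⟩
    intro y
    have : k⁻¹ * (k₀ * rep ((fun x => k₀⁻¹ * k * x) '' {k : G | ∀ y : Y, k • y = y})) = κ := by
      rw [← hκ']
      group
    rw [this]
    exact hκ y
  · exact ⟨∅, Set.finite_empty, fun k ha hb => absurd ⟨k, ha, hb⟩ hex⟩

end Action

/-- A separable set can be separated from finitely many elements at once. -/
theorem IsSeparableSet.exists_finiteIndex {G : Type*} [Group G] {S : Set G}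
    (hS : IsSeparableSet S) {P : Set G} (hP : P.Finite) :
    ∃ H : Subgroup G, H.FiniteIndex ∧ S ⊆ H ∧ ∀ p ∈ P, p ∈ H → p ∈ S := by
  induction P, hP using Set.Finite.induction_on with
  | empty => exact ⟨⊤, inferInstance, fun _ _ => trivial, fun _ h => h.elim⟩
  | @insert a P _ _ ih =>
    obtain ⟨H, hH, hSH, hPH⟩ := ih
    by_cases ha : a ∈ S
    · refine ⟨H, hH, hSH, ?_⟩
      rintro p (rfl | hp) hpH
      · exact ha
      · exact hPH p hp hpH
    · have ha' := ha
      rw [hS] at ha'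
      simp only [Set.mem_iInter, not_forall] at ha'
      obtain ⟨L, ⟨hSL, hL⟩, haL⟩ := ha'
      refine ⟨H ⊓ L, inferInstance, fun s hs => ⟨hSH hs, hSL hs⟩, ?_⟩
      rintro p (rfl | hp) hpH
      · exact absurd hpH.2 haL
      · exact hPH p hp hpH.1

theorem IsSeparableSet.exists_subgroup {G : Type*} [Group G] {S : Set G}
    (hS : IsSeparableSet S) : ∃ H : Subgroup G, (H : Set G) = S := by
  refine ⟨⨅ K ∈ {K : Subgroup G | S ⊆ K ∧ K.FiniteIndex}, K, ?_⟩
  conv_rhs => rw [hS]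
  simp only [Subgroup.coe_iInf]

theorem finite_index_subgroup_with_bounded_projections
    (δ lam c : ℝ) (hδ : 0 ≤ δ) (hlam : 1 ≤ lam) (hc : 0 ≤ c)
    (R N : ℝ → ℝ) :
    ∃ θ : ℝ, 0 < θ ∧
      ∀ (Y : Type*) [MetricSpace Y], IsGeodesicSpace Y → IsDeltaHyperbolic Y δ →
      ∀ (G : Type*) [Group G] [MulAction G Y],
        (∀ g : G, Isometry (fun y : Y => g • y)) →
        -- acylindrical image, quantified by the functions R and N
        (∀ r : ℝ, 0 ≤ r → ∀ a b : Y, R r ≤ dist a b →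
          {S : Set G | ∃ g : G, dist (g • a) a ≤ r ∧ dist (g • b) b ≤ r ∧
              S = (fun x => g * x) '' {k : G | ∀ y : Y, k • y = y}}.Finite ∧
          (({S : Set G | ∃ g : G, dist (g • a) a ≤ r ∧ dist (g • b) b ≤ r ∧
              S = (fun x => g * x) '' {k : G | ∀ y : Y, k • y = y}}.ncard : ℝ) ≤ N r)) →
        ∀ g : G,
        -- g is loxodromic
        (∃ x : Y, ∃ lam' c' : ℝ, 1 ≤ lam' ∧ 0 ≤ c' ∧ ∀ m n : ℤ,
          (1 / lam') * |(m : ℝ) - n| - c' ≤ dist ((g ^ m) • x) ((g ^ n) • x) ∧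
          dist ((g ^ m) • x) ((g ^ n) • x) ≤ lam' * |(m : ℝ) - n| + c') →
        ∀ A : Set Y,
        -- A is a (lam, c)-quasi-axis for g
        g • A = A → (∃ γ : ℝ → Y, IsQuasiGeodesicOn lam c γ Set.univ ∧ A = Set.range γ) →
        -- EC(g) is separable in G
        IsSeparableSet {h : G | EMetric.hausdorffEdist (h • A) A ≠ ⊤} →
        ∃ G' : Subgroup G, G'.FiniteIndex ∧
          ∀ h ∈ G', EMetric.hausdorffEdist (h • A) A ≠ ⊤ ∨
            Metric.diam (approxProj A (h • A)) < θ := by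
  obtain ⟨B, hB0, hB⟩ := exists_quasiconvexity_constant c hδ hlam
  obtain ⟨r, hr⟩ : ∃ r, r = 2 * (2 * δ + B + 1) + 2 * (lam + c) := ⟨_, rfl⟩
  obtain ⟨E, hE⟩ : ∃ E, E = 4 * δ + B + 2 := ⟨_, rfl⟩
  obtain ⟨L, hL⟩ : ∃ L, L = max 0 (R (2 * r) + 2 * (2 * δ + B + 1) + 2 * (lam + c)) := ⟨_, rfl⟩
  have hL0 : 0 ≤ L := hL ▸ le_max_left _ _
  have hLR : R (2 * r) + 2 * (2 * δ + B + 1) + 2 * (lam + c) ≤ L := hL ▸ le_max_right _ _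
  refine ⟨2 * E + L + 1, by linarith, ?_⟩
  intro Y _ hgeo hhyp G _ _ hiso hacyl g hlox A hgA hqa hsep
  obtain ⟨γ, hγ, rfl⟩ := hqa
  have hthin := hhyp.hasThinTriangles hgeo
  have hA : (Set.range γ).Nonempty := ⟨γ 0, 0, rfl⟩
  have hconv := hB Y hgeo hthin γ hγ
  obtain ⟨T, hT⟩ := exists_cobounded_on_quasiAxis hiso hlox hlam hγ hgA
  obtain ⟨F, hF, hnet⟩ := hγ.exists_finite_net hlam (T + (L + 2 * (2 * δ + B + 1)))
  have hreps : ∀ f : (Y × Y) × (Y × Y), ∃ P : Set G, P.Finite ∧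
      (R (2 * r) ≤ dist f.2.1 f.2.2 → ∀ k : G, dist (k • f.2.1) f.1.1 ≤ r →
        dist (k • f.2.2) f.1.2 ≤ r → ∃ p ∈ P, ∀ y : Y, (k⁻¹ * p) • y = y) := by
    intro f
    by_cases hf : R (2 * r) ≤ dist f.2.1 f.2.2
    · obtain ⟨P, hP, h⟩ := exists_finite_coset_representatives (a' := f.1.1) (b' := f.1.2) hiso
        (hacyl (2 * r) (by linarith) _ _ hf).1
      exact ⟨P, hP, fun _ => h⟩
    · exact ⟨∅, Set.finite_empty, fun h => absurd h hf⟩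
  choose P hPfin hP using hreps
  obtain ⟨H, hH, hECH, hPH⟩ := hsep.exists_finiteIndex
    (((hF.prod hF).prod (hF.prod hF)).biUnion fun f _ => hPfin f)
  obtain ⟨EC, hEC⟩ := hsep.exists_subgroup
  have mem_EC : ∀ k : G, k ∈ EC ↔
      EMetric.hausdorffEdist (k • Set.range γ) (Set.range γ) ≠ ⊤ := fun k => by
    rw [← SetLike.mem_coe, hEC]
    rfl
  have EC_le : EC ≤ H := fun k hk => hECH (hEC ▸ hk)
  have stab_mem : ∀ k : G, k • Set.range γ = Set.range γ → k ∈ EC := fun k hk => by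
    rw [mem_EC, hk]
    exact Metric.hausdorffEDist_self.trans_ne ENNReal.zero_ne_top
  have hg := stab_mem g hgA
  refine ⟨H, hH, fun h hh => ?_⟩
  rw [or_iff_not_imp_left, ← mem_EC]
  intro hhEC
  suffices hdist : ∀ p ∈ approxProj (Set.range γ) (h • Set.range γ),
      ∀ q ∈ approxProj (Set.range γ) (h • Set.range γ), dist p q ≤ 2 * E + L by
    have := Metric.diam_le_of_forall_dist_le (by linarith) hdist
    linarith
  rintro p ⟨hp, x, hx, hxp⟩ q ⟨hq, y, hy, hyq⟩
  by_contra! hpq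
  -- points on a geodesic from `p` to `q` away from the endpoints are close to both quasi-axes
  have near : ∀ s, E ≤ s → s ≤ E + L → ∀ m, MetricBetween p m q → dist p m = s →
      ∃ a ∈ Set.range γ, ∃ a' ∈ Set.range γ,
        dist m a ≤ 2 * δ + B + 1 ∧ dist m (h • a') ≤ 2 * δ + B + 1 := by
    intro s hs hs' m hm hpm
    have hmA := hconv p hp q hq m hm
    have hqm : dist q m = dist p q - s := by
      unfold MetricBetween at hm
      rw [dist_comm]
      linarith
    obtain ⟨u, hmu, hu⟩ := hthin.exists_near_of_approxProj hδ hp hq hxp hyq hm hmA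
      (by linarith) (by linarith)
    obtain ⟨x', hx', rfl⟩ := hx
    obtain ⟨y', hy', rfl⟩ := hy
    have hu' : MetricBetween x' (h⁻¹ • u) y' := by
      unfold MetricBetween at hu ⊢
      rw [← dist_smul_of_isometry hiso h, ← dist_smul_of_isometry hiso h (h⁻¹ • u),
        ← dist_smul_of_isometry hiso h x' y', smul_inv_smul]
      exact hu
    obtain ⟨a, ha, hma⟩ := (Metric.infDist_lt_iff hA).1 (hmA.trans_lt (lt_add_one B))
    obtain ⟨a', ha', hua'⟩ := (Metric.infDist_lt_iff hA).1
      ((hconv x' hx' y' hy' _ hu').trans_lt (lt_add_one B))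
    refine ⟨a, ha, a', ha', by linarith, ?_⟩
    rw [← dist_smul_of_isometry hiso h, smul_inv_smul] at hua'
    linarith [dist_triangle m u (h • a')]
  obtain ⟨n, hn, hpn⟩ := hgeo.exists_metricBetween p q (r := E + L) (by linarith) (by linarith)
  obtain ⟨m, hm, hpm⟩ := hgeo.exists_metricBetween p n (r := E) (by linarith) (by linarith)
  have hmn : dist m n = L := by
    unfold MetricBetween at hm
    linarith
  obtain ⟨a, ha, a', ha', hma, hma'⟩ :=
    near E le_rfl (by linarith) m (hn.trans_left hm).1 hpm
  obtain ⟨b, hb, b', hb', hnb, hnb'⟩ := near (E + L) (by linarith) le_rfl n hn hpn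
  rw [dist_comm] at hma hma'
  have hab : dist b a ≤ L + 2 * (2 * δ + B + 1) := by
    have := dist_triangle4 a m n b
    rw [dist_comm b a]
    linarith
  have hab' : |dist b' a' - L| ≤ 2 * (2 * δ + B + 1) := by
    rw [← dist_smul_of_isometry hiso h, dist_comm (h • b')]
    have h₁ := dist_triangle4 (h • a') m n (h • b')
    have h₂ := dist_triangle4 m (h • a') (h • b') n
    rw [dist_comm m (h • a'), dist_comm (h • b') n] at h₂
    rw [abs_le]
    constructor <;> linarith
  have haa' : dist (h • a') a ≤ 2 * (2 * δ + B + 1) := by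
    have := dist_triangle_right (h • a') a m
    linarith
  have hbb' : dist (h • b') b ≤ 2 * (2 * δ + B + 1) := by
    have := dist_triangle_left (h • b') b n
    linarith
  have net : ∀ a ∈ Set.range γ, ∀ b ∈ Set.range γ, dist b a ≤ L + 2 * (2 * δ + B + 1) →
      ∃ i : ℤ, ∃ f ∈ F, ∃ f' ∈ F, dist (g ^ i • a) f ≤ lam + c ∧
        dist (g ^ i • b) f' ≤ lam + c := by
    intro a ha b hb hab
    obtain ⟨i, hi⟩ := hT a ha
    have hbi : dist (g ^ i • b) (γ 0) ≤ T + (L + 2 * (2 * δ + B + 1)) := by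
      have := dist_triangle (g ^ i • b) (g ^ i • a) (γ 0)
      rw [dist_smul_of_isometry hiso] at this
      linarith
    obtain ⟨f, hf, hfa⟩ := hnet _ (zpow_smul_mem hgA i ha) (by linarith)
    obtain ⟨f', hf', hfb⟩ := hnet _ (zpow_smul_mem hgA i hb) hbi
    exact ⟨i, f, hf, f', hf', hfa, hfb⟩
  obtain ⟨i, f₁, hf₁, f₂, hf₂, hf₁a, hf₂b⟩ := net a ha b hb hab
  obtain ⟨j, f₃, hf₃, f₄, hf₄, hf₃a, hf₄b⟩ :=
    net a' ha' b' hb' (by linarith [(abs_le.1 hab').2])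
  have hR : R (2 * r) ≤ dist f₃ f₄ := by
    have h₁ := dist_triangle4 (g ^ j • a') f₃ f₄ (g ^ j • b')
    rw [dist_smul_of_isometry hiso, dist_comm f₄, dist_comm a' b'] at h₁
    linarith [(abs_le.1 hab').1]
  have hk : ∀ a a' f f' : Y, dist (h • a') a ≤ 2 * (2 * δ + B + 1) →
      dist (g ^ i • a) f ≤ lam + c → dist (g ^ j • a') f' ≤ lam + c →
      dist ((g ^ i * h * (g ^ j)⁻¹) • f') f ≤ r := by
    intro a a' f f' h₁ h₂ h₃
    have h₄ := dist_triangle4 ((g ^ i * h * (g ^ j)⁻¹) • f')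
      ((g ^ i * h * (g ^ j)⁻¹) • g ^ j • a') (g ^ i • a) f
    rw [dist_smul_of_isometry hiso, dist_comm f', smul_smul, inv_mul_cancel_right, mul_smul _ _ a',
      dist_smul_of_isometry hiso] at h₄
    linarith
  obtain ⟨k, hkP, hkK⟩ := hP ((f₁, f₂), (f₃, f₄)) hR (g ^ i * h * (g ^ j)⁻¹)
    (hk a a' f₁ f₃ haa' hf₁a hf₃a) (hk b b' f₂ f₄ hbb' hf₂b hf₄b)
  have hκ : (g ^ i * h * (g ^ j)⁻¹)⁻¹ * k ∈ EC := by
    refine stab_mem _ ?_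
    rw [← Set.image_smul]
    simp only [hkK, Set.image_id']
  have hgi := EC.zpow_mem hg i
  have hgj := EC.zpow_mem hg j
  have hkH : k ∈ H := by
    have := H.mul_mem (H.mul_mem (H.mul_mem (EC_le hgi) hh) (H.inv_mem (EC_le hgj))) (EC_le hκ)
    rwa [mul_inv_cancel_left] at this
  have hkEC : k ∈ EC := by
    rw [← SetLike.mem_coe, hEC]
    exact hPH k (Set.mem_biUnion (Set.mk_mem_prod (Set.mk_mem_prod hf₁ hf₂)
      (Set.mk_mem_prod hf₃ hf₄)) hkP) hkH
  apply hhEC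
  have h₁ := EC.mul_mem hkEC (EC.inv_mem hκ)
  have h₂ := EC.mul_mem (EC.mul_mem (EC.inv_mem hgi) h₁) hgj
  convert h₂ using 1
  group
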